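/- Let N : ℝ × ℝ → ℝ be continuous and satisfy the multiplicativity condition N(θ(t)·q, t) = θ(t)·N(q, t) for all q, t ∈ ℝ. Let s ∈ ℝ and let w₀ : ℝ → ℝ be twice continuously differentiable with w₀''(t) + N(w₀(t), t) = 0 for all t, w₀(0) = 0 and w₀'(0) = s. Then G = θ·w₀ satisfies G'' + N(G, t) = s·δ in the sense of distributions; explicitly, for every test function φ : ℝ → ℝ, ∫_ℝ θ(t)·w₀(t)·φ''(t) dt + ∫_ℝ N(θ(t)·w₀(t), t)·φ(t) dt = s·φ(0). -/

import Mathlib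

open MeasureTheory

/-- The Heaviside step function: `1` for `t ≥ 0` and `0` for `t < 0`. -/
noncomputable def heaviside (t : ℝ) : ℝ := if 0 ≤ t then 1 else 0

theorem integral_heaviside_mul (g : ℝ → ℝ) :
    ∫ t, heaviside t * g t = ∫ t in Set.Ioi 0, g t := by
  rw [← integral_Ici_eq_integral_Ioi, ← integral_indicator measurableSet_Ici]
  congr with t
  by_cases ht : 0 ≤ t <;> simp [heaviside, ht]

/-- Green's second identity on a half-line, with a compactly supported factor. -/
theorem integral_Ioi_mul_deriv_deriv_sub {u φ : ℝ → ℝ} (hu : ContDiff ℝ 2 u)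
    (hφ : ContDiff ℝ 2 φ) (hc : HasCompactSupport φ) (a : ℝ) :
    ∫ t in Set.Ioi a, (u t * deriv (deriv φ) t - deriv (deriv u) t * φ t) =
      deriv u a * φ a - u a * deriv φ a := by
  have hu' : ContDiff ℝ 1 (deriv u) := ContDiff.deriv' (by simpa [one_add_one_eq_two] using hu)
  have hφ' : ContDiff ℝ 1 (deriv φ) := ContDiff.deriv' (by simpa [one_add_one_eq_two] using hφ)
  have h1 : ContDiff ℝ 1 (fun t => u t * deriv φ t - deriv u t * φ t) :=
    ((hu.of_le (by norm_num)).mul hφ').sub (hu'.mul (hφ.of_le (by norm_num)))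
  have hsupp : HasCompactSupport (fun t => u t * deriv φ t - deriv u t * φ t) :=
    (hc.deriv.mul_left (f' := deriv φ)).sub hc.mul_left
  have hderiv : deriv (fun t => u t * deriv φ t - deriv u t * φ t) =
      fun t => u t * deriv (deriv φ) t - deriv (deriv u) t * φ t := by
    ext t
    have a1 := (hu.differentiable (by norm_num) t).hasDerivAt
    have a2 := (hu'.differentiable (by norm_num) t).hasDerivAt
    have b1 := (hφ.differentiable (by norm_num) t).hasDerivAt
    have b2 := (hφ'.differentiable (by norm_num) t).hasDerivAt
    refine ((a1.mul b2).sub (a2.mul b1)).deriv.trans ?_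
    ring
  rw [← hderiv, hsupp.integral_Ioi_deriv_eq h1, neg_sub]

/-- If `N(q, t)` satisfies the multiplicativity condition and `w₀` solves the homogeneous
Cauchy problem `w₀'' + N(w₀, t) = 0`, `w₀(0) = 0`, `w₀'(0) = s`, then
`G = θ·w₀` satisfies `G'' + N(G, t) = s·δ` in the sense of distributions. -/
theorem green_representation (N : ℝ × ℝ → ℝ) (hN : Continuous N)
    (hmul : ∀ q t : ℝ, N (heaviside t * q, t) = heaviside t * N (q, t))
    (s : ℝ) (w₀ : ℝ → ℝ) (hw₀ : ContDiff ℝ 2 w₀)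
    (hode : ∀ t : ℝ, deriv (deriv w₀) t + N (w₀ t, t) = 0)
    (hinit : w₀ 0 = 0) (hinit' : deriv w₀ 0 = s) :
    ∀ φ : ℝ → ℝ, ContDiff ℝ (⊤ : ℕ∞) φ → HasCompactSupport φ →
      (∫ t : ℝ, heaviside t * w₀ t * deriv (deriv φ) t) +
        (∫ t : ℝ, N (heaviside t * w₀ t, t) * φ t) =
      s * φ 0 := by
  intro φ hφ hc
  have hφ2 : ContDiff ℝ 2 φ := contDiff_infty.mp hφ 2
  have hφ'' : Continuous (deriv (deriv φ)) :=
    (contDiff_infty_iff_deriv.mp hφ).2.continuous_deriv (by simp)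
  have hw := hw₀.continuous
  have i1 : Integrable (fun t => w₀ t * deriv (deriv φ) t) :=
    (hw.mul hφ'').integrable_of_hasCompactSupport hc.deriv.deriv.mul_left
  have i2 : Integrable (fun t => N (w₀ t, t) * φ t) :=
    Continuous.integrable_of_hasCompactSupport (by fun_prop) hc.mul_left
  simp only [hmul, mul_assoc]
  rw [integral_heaviside_mul, integral_heaviside_mul,
    ← integral_add i1.integrableOn i2.integrableOn]
  have key := integral_Ioi_mul_deriv_deriv_sub hw₀ hφ2 hc 0
  rw [hinit, hinit', zero_mul, sub_zero] at key
  rw [← key]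
  congr with t
  linear_combination φ t * hode t
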